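/- Let G=(V,E) be a finite directed graph with n vertices and m edges, let k ≥ 1 be an integer and ε > 0 a real number, and let F be a finite family of separation triples (L,S,R) of G whose left parts L are pairwise disjoint, such that Σ_{(L,S,R)∈F} max(k − |S|, 0) > εm/2. For each i ∈ {0, 1, …, ⌊log₂ k⌋}, let C_i = {(L,S,R) ∈ F : 2^i ≤ k − |S| < 2^{i+1}} and C_{i,small} = {(L,S,R) ∈ C_i : vol^out(L) < 2^{i+3} ε^{−1} (⌊log₂ k⌋ + 1)}. Then there exists i* ∈ {0, 1, …, ⌊log₂ k⌋} such that |C_{i*,small}| > εm / (2^{i*+3}(⌊log₂ k⌋ + 1)) ≥ εm / (8k(⌊log₂ k⌋ + 1)). In particular, if additionally m ≥ nk/4, then |C_{i*,small}| > εn / (32(⌊log₂ k⌋ + 1)). -/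

import Mathlib

/-- The out-volume of `X`: the number of edges of `E` whose tail lies in `X`. -/
def volOut {V : Type*} [DecidableEq V] (E : Finset (V × V)) (X : Finset V) : ℕ :=
  (E.filter (fun e => e.1 ∈ X)).card

/-- `(L, S, R)` is a separation triple: `L, S, R` partition `V`, `L` and `R` are
nonempty, and there is no edge from `L` to `R`. -/
def IsSepTriple {V : Type*} [Fintype V] [DecidableEq V]
    (E : Finset (V × V)) (L S R : Finset V) : Prop :=
  L.Nonempty ∧ R.Nonempty ∧ Disjoint L S ∧ Disjoint L R ∧ Disjoint S R ∧
    L ∪ S ∪ R = Finset.univ ∧ ∀ e ∈ E, e.1 ∈ L → e.2 ∉ R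

/-- Vertex sets with pairwise disjoint left parts have total out-volume at most the number of
edges. -/
theorem sum_volOut_le_card {V ι : Type*} [DecidableEq V] (E : Finset (V × V))
    (A : Finset ι) (L : ι → Finset V)
    (hdisj : ∀ t ∈ A, ∀ t' ∈ A, t ≠ t' → Disjoint (L t) (L t')) :
    ∑ t ∈ A, volOut E (L t) ≤ E.card := by
  classical
  unfold volOut
  rw [← Finset.card_biUnion]
  · exact Finset.card_le_card (Finset.biUnion_subset.2 fun t _ => Finset.filter_subset _ _)
  · intro t ht t' ht' hne
    refine Finset.disjoint_filter.2 fun e _ h h' => ?_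
    exact Finset.disjoint_left.1 (hdisj t ht t' ht' hne) h h'

/-- A family with pairwise disjoint left parts has few members of out-volume at least `c`. -/
theorem card_mul_le_card_of_le_volOut {V ι : Type*} [DecidableEq V] (E : Finset (V × V))
    (A : Finset ι) (L : ι → Finset V)
    (hdisj : ∀ t ∈ A, ∀ t' ∈ A, t ≠ t' → Disjoint (L t) (L t'))
    (c : ℝ) (hc : ∀ t ∈ A, c ≤ (volOut E (L t) : ℝ)) :
    (A.card : ℝ) * c ≤ E.card := by
  calc (A.card : ℝ) * c = ∑ t ∈ A, c := by simp
    _ ≤ ∑ t ∈ A, (volOut E (L t) : ℝ) := Finset.sum_le_sum hc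
    _ ≤ E.card := by exact_mod_cast sum_volOut_le_card E A L hdisj

open Classical in
/-- If at most `ε m / (2 ^ (i + 3) l)` members of a family with disjoint left parts have small
out-volume, then the whole family, weighted by `2 ^ (i + 1)`, contributes at most `ε m / (2 l)`. -/
theorem card_mul_le_of_card_small_le {V ι : Type*} [DecidableEq V] (E : Finset (V × V))
    (C : Finset ι) (L : ι → Finset V)
    (hdisj : ∀ t ∈ C, ∀ t' ∈ C, t ≠ t' → Disjoint (L t) (L t'))
    {ε l : ℝ} (hε : 0 < ε) (hl : 0 < l) (i : ℕ)
    (h_small : ((C.filter fun t => (volOut E (L t) : ℝ) < (2 : ℝ) ^ (i + 3) * ε⁻¹ * l).card : ℝ) ≤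
      ε * E.card / ((2 : ℝ) ^ (i + 3) * l)) :
    (C.card : ℝ) * (2 : ℝ) ^ (i + 1) ≤ ε * E.card / (2 * l) := by
  have hc0 : 0 < (2 : ℝ) ^ (i + 3) * ε⁻¹ * l := by positivity
  have h_bound : ε * E.card / ((2 : ℝ) ^ (i + 3) * l) =
      E.card / ((2 : ℝ) ^ (i + 3) * ε⁻¹ * l) := by
    field_simp
  have h_large := card_mul_le_card_of_le_volOut E
    (C.filter fun t => ¬ (volOut E (L t) : ℝ) < (2 : ℝ) ^ (i + 3) * ε⁻¹ * l) L
    (fun t ht t' ht' => hdisj t (Finset.mem_filter.1 ht).1 t' (Finset.mem_filter.1 ht').1)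
    _ (fun t ht => not_lt.1 (Finset.mem_filter.1 ht).2)
  rw [← le_div_iff₀ hc0, ← h_bound] at h_large
  have h_card : (C.card : ℝ) =
      ((C.filter fun t => (volOut E (L t) : ℝ) < (2 : ℝ) ^ (i + 3) * ε⁻¹ * l).card : ℝ) +
      ((C.filter fun t => ¬ (volOut E (L t) : ℝ) < (2 : ℝ) ^ (i + 3) * ε⁻¹ * l).card : ℝ) := by
    exact_mod_cast (Finset.card_filter_add_card_filter_not _).symm
  calc (C.card : ℝ) * 2 ^ (i + 1)
      ≤ (2 * (ε * E.card / ((2 : ℝ) ^ (i + 3) * l))) * 2 ^ (i + 1) := by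
        gcongr
        linarith
    _ = ε * E.card / (2 * l) := by
        field_simp
        ring

open Classical in
/-- The positive part of `k - s` is at most the sum of `2 ^ (i + 1)` over the dyadic scales `i`
to which `k - s` belongs. -/
theorem max_sub_le_sum_dyadic (k s : ℕ) :
    max ((k : ℝ) - (s : ℝ)) 0 ≤ ∑ i ∈ Finset.range (Nat.log 2 k + 1),
      if (2 : ℤ) ^ i ≤ (k : ℤ) - (s : ℤ) ∧ (k : ℤ) - (s : ℤ) < 2 ^ (i + 1)
        then (2 : ℝ) ^ (i + 1) else 0 := by
  have h_nonneg : ∀ i ∈ Finset.range (Nat.log 2 k + 1), (0 : ℝ) ≤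
      if (2 : ℤ) ^ i ≤ (k : ℤ) - (s : ℤ) ∧ (k : ℤ) - (s : ℤ) < 2 ^ (i + 1)
        then (2 : ℝ) ^ (i + 1) else 0 := by
    intro i _
    split_ifs <;> positivity
  refine max_le ?_ (Finset.sum_nonneg h_nonneg)
  rcases le_or_gt k s with h | h
  · have : (k : ℝ) ≤ s := by exact_mod_cast h
    exact (sub_nonpos.2 this).trans (Finset.sum_nonneg h_nonneg)
  · obtain ⟨d, rfl⟩ := Nat.exists_eq_add_of_le h.le
    have hd : d ≠ 0 := by omega
    have h1 : 2 ^ Nat.log 2 d ≤ d := Nat.pow_log_le_self 2 hd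
    have h2 : d < 2 ^ (Nat.log 2 d + 1) := Nat.lt_pow_succ_log_self (by norm_num) d
    have hmem : Nat.log 2 d ∈ Finset.range (Nat.log 2 (s + d) + 1) :=
      Finset.mem_range.2 (Nat.lt_succ_of_le (Nat.log_mono_right (by omega)))
    refine le_trans ?_ (Finset.single_le_sum h_nonneg hmem)
    have h_sub : ((s + d : ℕ) : ℤ) - (s : ℤ) = d := by push_cast; ring
    rw [h_sub, if_pos ⟨by exact_mod_cast h1, by exact_mod_cast h2⟩]
    have h3 : (d : ℝ) < 2 ^ (Nat.log 2 d + 1) := by exact_mod_cast h2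
    push_cast
    linarith

/- **Statement 12.**
Let `G = (V, E)` be a finite directed graph with `n` vertices and `m` edges,
let `k ≥ 1` be an integer and `ε > 0` a real number, and let `F` be a finite
family of separation triples `(L, S, R)` of `G` whose left parts are pairwise
disjoint, such that `Σ_{(L,S,R) ∈ F} max(k − |S|, 0) > εm/2`.  For each
`i ∈ {0, …, ⌊log₂ k⌋}` let `C_i = {(L,S,R) ∈ F : 2^i ≤ k − |S| < 2^(i+1)}`
and `C_{i,small} = {(L,S,R) ∈ C_i : vol^out(L) < 2^(i+3) ε⁻¹ (⌊log₂ k⌋ + 1)}`.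
Then there exists `i* ∈ {0, …, ⌊log₂ k⌋}` such that
`|C_{i*,small}| > εm / (2^(i*+3)(⌊log₂ k⌋ + 1)) ≥ εm / (8k(⌊log₂ k⌋ + 1))`.
In particular, if additionally `m ≥ nk/4`, then
`|C_{i*,small}| > εn / (32(⌊log₂ k⌋ + 1))`. -/
open Classical in
theorem stmt_12 {V : Type*} [Fintype V] [DecidableEq V]
    (E : Finset (V × V)) (k : ℕ) (hk : 1 ≤ k) (ε : ℝ) (hε : 0 < ε)
    (F : Finset (Finset V × Finset V × Finset V))
    (hsep : ∀ t ∈ F, IsSepTriple E t.1 t.2.1 t.2.2)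
    (hdisj : ∀ t ∈ F, ∀ t' ∈ F, t ≠ t' → Disjoint t.1 t'.1)
    (hsum : ε * E.card / 2 < ∑ t ∈ F, max ((k : ℝ) - (t.2.1.card : ℝ)) 0) :
    ∃ i ≤ Nat.log 2 k,
      (ε * E.card / ((2 : ℝ) ^ (i + 3) * ((Nat.log 2 k : ℝ) + 1)) <
        ((F.filter (fun t =>
            ((2 : ℤ) ^ i ≤ (k : ℤ) - (t.2.1.card : ℤ) ∧
              (k : ℤ) - (t.2.1.card : ℤ) < 2 ^ (i + 1)) ∧
            (volOut E t.1 : ℝ) <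
              (2 : ℝ) ^ (i + 3) * ε⁻¹ * ((Nat.log 2 k : ℝ) + 1))).card : ℝ)) ∧
      (ε * E.card / (8 * (k : ℝ) * ((Nat.log 2 k : ℝ) + 1)) ≤
        ε * E.card / ((2 : ℝ) ^ (i + 3) * ((Nat.log 2 k : ℝ) + 1))) ∧
      ((Fintype.card V : ℝ) * k / 4 ≤ (E.card : ℝ) →
        ε * (Fintype.card V : ℝ) / (32 * ((Nat.log 2 k : ℝ) + 1)) <
          ((F.filter (fun t =>
              ((2 : ℤ) ^ i ≤ (k : ℤ) - (t.2.1.card : ℤ) ∧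
                (k : ℤ) - (t.2.1.card : ℤ) < 2 ^ (i + 1)) ∧
              (volOut E t.1 : ℝ) <
                (2 : ℝ) ^ (i + 3) * ε⁻¹ * ((Nat.log 2 k : ℝ) + 1))).card : ℝ)) := by
  have hl : (0 : ℝ) < (Nat.log 2 k : ℝ) + 1 := by positivity
  have hk0 : (0 : ℝ) < k := by exact_mod_cast hk
  obtain ⟨i, hi, h_small⟩ : ∃ i ≤ Nat.log 2 k,
      ε * E.card / ((2 : ℝ) ^ (i + 3) * ((Nat.log 2 k : ℝ) + 1)) <
        ((F.filter (fun t =>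
            ((2 : ℤ) ^ i ≤ (k : ℤ) - (t.2.1.card : ℤ) ∧
              (k : ℤ) - (t.2.1.card : ℤ) < 2 ^ (i + 1)) ∧
            (volOut E t.1 : ℝ) <
              (2 : ℝ) ^ (i + 3) * ε⁻¹ * ((Nat.log 2 k : ℝ) + 1))).card : ℝ) := by
    by_contra! hcon
    refine absurd hsum (not_lt.2 ?_)
    calc ∑ t ∈ F, max ((k : ℝ) - (t.2.1.card : ℝ)) 0
        ≤ ∑ t ∈ F, ∑ i ∈ Finset.range (Nat.log 2 k + 1),
            if (2 : ℤ) ^ i ≤ (k : ℤ) - (t.2.1.card : ℤ) ∧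
              (k : ℤ) - (t.2.1.card : ℤ) < 2 ^ (i + 1)
            then (2 : ℝ) ^ (i + 1) else 0 :=
          Finset.sum_le_sum fun t _ => max_sub_le_sum_dyadic k t.2.1.card
      _ = ∑ i ∈ Finset.range (Nat.log 2 k + 1),
            ((F.filter (fun t => (2 : ℤ) ^ i ≤ (k : ℤ) - (t.2.1.card : ℤ) ∧
              (k : ℤ) - (t.2.1.card : ℤ) < 2 ^ (i + 1))).card : ℝ) * (2 : ℝ) ^ (i + 1) := by
          rw [Finset.sum_comm]
          refine Finset.sum_congr rfl fun i _ => ?_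
          rw [← Finset.sum_filter, Finset.sum_const, nsmul_eq_mul]
      _ ≤ ∑ i ∈ Finset.range (Nat.log 2 k + 1),
            ε * E.card / (2 * ((Nat.log 2 k : ℝ) + 1)) := by
          refine Finset.sum_le_sum fun i hi => ?_
          refine card_mul_le_of_card_small_le E _ (fun t => t.1)
            (fun t ht t' ht' => hdisj t (Finset.mem_filter.1 ht).1
              t' (Finset.mem_filter.1 ht').1) hε hl i ?_
          rw [Finset.filter_filter]
          convert hcon i (Nat.lt_succ_iff.1 (Finset.mem_range.1 hi))
      _ = ε * E.card / 2 := by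
          rw [Finset.sum_const, Finset.card_range, nsmul_eq_mul]
          push_cast
          field_simp
  have h_scale : ε * E.card / (8 * (k : ℝ) * ((Nat.log 2 k : ℝ) + 1)) ≤
      ε * E.card / ((2 : ℝ) ^ (i + 3) * ((Nat.log 2 k : ℝ) + 1)) := by
    have h_pow : (2 : ℝ) ^ i ≤ k := by
      exact_mod_cast Nat.pow_le_of_le_log (by omega) hi
    have h_pow' : (2 : ℝ) ^ (i + 3) ≤ 8 * k := by
      rw [pow_add]
      linarith
    gcongr
  refine ⟨i, hi, h_small, h_scale, fun hn => lt_of_le_of_lt ?_ (h_scale.trans_lt h_small)⟩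
  calc ε * (Fintype.card V : ℝ) / (32 * ((Nat.log 2 k : ℝ) + 1))
      = ε * ((Fintype.card V : ℝ) * k / 4) / (8 * (k : ℝ) * ((Nat.log 2 k : ℝ) + 1)) := by
        field_simp
        ring
    _ ≤ ε * E.card / (8 * (k : ℝ) * ((Nat.log 2 k : ℝ) + 1)) := by gcongr
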